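/- Let A = {(diag(a,1/a), 0) : a > 0} ⊂ G and V_∞ = {(I,(0,t)) : t ∈ ℝ} ⊂ G. Let v_n = (α_n, β_n) ∈ ℝ² with |β_n| → ∞ and α_n/β_n → 0. Then (I,v_n) A (I,v_n)⁻¹ → V_∞ in the Chabauty sense. -/

import Mathlib

open Matrix Filter Topology

/-- `SL2` is the special linear group `SL(2,ℝ)`. -/
abbrev SL2 : Type := Matrix.SpecialLinearGroup (Fin 2) ℝ

/-- `M2` is the space of 2×2 real matrices. -/
abbrev M2 : Type := Matrix (Fin 2) (Fin 2) ℝ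

noncomputable instance : TopologicalSpace SL2 :=
  TopologicalSpace.induced (fun g => (g : M2)) inferInstance

/-- Chabauty-sense convergence of a sequence of subsets of a topological space `X`:
(i) every point of the limit is a limit of a sequence of points of the `H n`;
(ii) every convergent sequence `x (k n) ∈ H (k n)` along a strictly increasing sequence
of indices has its limit in `L`. -/
def ChabautyTendsto {X : Type*} [TopologicalSpace X] (H : ℕ → Set X) (L : Set X) : Prop :=
  (∀ h ∈ L, ∃ u : ℕ → X, (∀ n, u n ∈ H n) ∧ Filter.Tendsto u Filter.atTop (nhds h)) ∧
  (∀ k : ℕ → ℕ, StrictMono k → ∀ x : ℕ → X, (∀ n, x n ∈ H (k n)) →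
    ∀ l : X, Filter.Tendsto x Filter.atTop (nhds l) → l ∈ L)

/-- Conjugate `x S x⁻¹` of a subset `S` of a group by a group element `x`. -/
def conjSet {X : Type*} [Group X] (x : X) (S : Set X) : Set X :=
  (fun s => x * s * x⁻¹) '' S

/-- The group `G = SL(2,ℝ) ⋉ ℝ²`: elements are pairs `(g, v)`. -/
structure GSL : Type where
  g : SL2
  v : Fin 2 → ℝ

namespace GSL

noncomputable instance : TopologicalSpace GSL :=
  TopologicalSpace.induced (fun p => (p.g, p.v)) inferInstance

/-- Multiplication `(g,v)(g',v') = (gg', v + g·v')`. -/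
noncomputable instance : Mul GSL :=
  ⟨fun p q => ⟨p.g * q.g, p.v + (p.g : M2) *ᵥ q.v⟩⟩

noncomputable instance : One GSL := ⟨⟨1, 0⟩⟩

noncomputable instance : Inv GSL :=
  ⟨fun p => ⟨p.g⁻¹, -((↑(p.g⁻¹) : M2) *ᵥ p.v)⟩⟩

@[simp] lemma mul_def (p q : GSL) :
    p * q = ⟨p.g * q.g, p.v + (p.g : M2) *ᵥ q.v⟩ := rfl

@[simp] lemma one_def : (1 : GSL) = ⟨1, 0⟩ := rfl

@[simp] lemma inv_def (p : GSL) :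
    p⁻¹ = ⟨p.g⁻¹, -((↑(p.g⁻¹) : M2) *ᵥ p.v)⟩ := rfl

noncomputable instance : Group GSL where
  mul_assoc a b c := by
    simp only [mul_def, GSL.mk.injEq]
    refine ⟨mul_assoc _ _ _, ?_⟩
    simp only [Matrix.SpecialLinearGroup.coe_mul, Matrix.mulVec_add, Matrix.mulVec_mulVec, add_assoc]
  one_mul a := by
    simp only [one_def, mul_def, GSL.mk.injEq]
    simp
  mul_one a := by
    simp only [one_def, mul_def, GSL.mk.injEq]
    simp
  inv_mul_cancel a := by
    simp only [inv_def, mul_def, one_def, GSL.mk.injEq]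
    exact ⟨inv_mul_cancel _, neg_add_cancel _⟩

end GSL

/-- The unipotent matrix `(1, s; 0, 1)` as an element of `SL(2,ℝ)`. -/
noncomputable def sMat (s : ℝ) : SL2 :=
  ⟨!![1, s; 0, 1], by simp [Matrix.det_fin_two_of]⟩

/-- The diagonal matrix `diag(a, 1/a)` as an element of `SL(2,ℝ)` (for `a ≠ 0`). -/
noncomputable def aMat (a : ℝ) (ha : a ≠ 0) : SL2 :=
  ⟨!![a, 0; 0, a⁻¹], by simp [Matrix.det_fin_two_of, mul_inv_cancel₀ ha]⟩

/-- The diagonal subgroup `A = {(diag(a, 1/a), 0) : a > 0}` of `G`. -/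
def Aset : Set GSL := {p | (∃ a : ℝ, 0 < a ∧ (p.g : M2) = !![a, 0; 0, a⁻¹]) ∧ p.v = 0}

/-- The subgroup `V_∞ = {(I, (0, t)) : t ∈ ℝ}` of `G`. -/
def Vinf : Set GSL := {p | p.g = 1 ∧ ∃ t : ℝ, p.v = ![0, t]}

lemma gsl_tendsto_iff (x : ℕ → GSL) (l : GSL) :
    Tendsto x atTop (𝓝 l) ↔
      (∀ i j, Tendsto (fun n => ((x n).g : M2) i j) atTop (𝓝 ((l.g : M2) i j))) ∧
      (∀ i, Tendsto (fun n => (x n).v i) atTop (𝓝 (l.v i))) := by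
  have h1 : 𝓝 l = comap (fun p : GSL => (p.g, p.v)) (𝓝 (l.g, l.v)) := nhds_induced _ _
  have h2 : 𝓝 l.g = comap (fun g : SL2 => (g : M2)) (𝓝 (l.g : M2)) := nhds_induced _ _
  rw [h1, tendsto_comap_iff, nhds_prod_eq, tendsto_prod_iff', h2, tendsto_comap_iff]
  refine and_congr ?_ ?_
  · refine tendsto_pi_nhds.trans ?_
    exact forall_congr' fun i => tendsto_pi_nhds
  · exact tendsto_pi_nhds

lemma mem_conj_iff (α β : ℝ) (p : GSL) :
    p ∈ conjSet (⟨1, ![α, β]⟩ : GSL) Aset ↔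
      ∃ a : ℝ, 0 < a ∧ (p.g : M2) = !![a, 0; 0, a⁻¹] ∧ p.v = ![α * (1 - a), β * (1 - a⁻¹)] := by
  constructor
  · rintro ⟨⟨g, v⟩, ⟨⟨a, ha, hg⟩, hv⟩, rfl⟩
    simp only at hg hv
    refine ⟨a, ha, ?_, ?_⟩
    · simp [hg]
    · subst hv
      ext i
      fin_cases i <;> simp [hg, vecHead, vecTail] <;> ring
  · rintro ⟨a, ha, hg, hv⟩
    refine ⟨⟨p.g, 0⟩, ⟨⟨a, ha, hg⟩, rfl⟩, ?_⟩
    obtain ⟨g, v⟩ := p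
    simp only at hg hv
    simp only [GSL.mul_def, GSL.inv_def, GSL.mk.injEq]
    refine ⟨by simp, ?_⟩
    subst hv
    ext i
    fin_cases i <;> simp [hg, Matrix.mulVec, dotProduct, Fin.sum_univ_two] <;> ring

/-- If `vₙ = (αₙ, βₙ)` with `|βₙ| → ∞` and `αₙ/βₙ → 0`, then
`(I,vₙ) A (I,vₙ)⁻¹ → V_∞` in the Chabauty sense. -/
theorem diagonal_conj_tendsto_Vinf (α β : ℕ → ℝ)
    (hβ : Tendsto (fun n => |β n|) atTop atTop)
    (hr : Tendsto (fun n => α n / β n) atTop (𝓝 0)) :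
    ChabautyTendsto (fun n => conjSet (⟨1, ![α n, β n]⟩ : GSL) Aset) Vinf := by
  have hinv : Tendsto (fun n => (β n)⁻¹) atTop (𝓝 0) := by
    rw [tendsto_zero_iff_abs_tendsto_zero]
    refine hβ.inv_tendsto_atTop.congr fun n => ?_
    simp [abs_inv]
  have hne : ∀ᶠ n in atTop, β n ≠ 0 := by
    filter_upwards [hβ.eventually_gt_atTop 0] with n hn
    exact abs_pos.mp hn
  constructor
  · rintro ⟨g, v⟩ ⟨hg, t, hv⟩
    simp only at hg hv
    subst hg hv
    have hd : Tendsto (fun n => 1 - t * (β n)⁻¹) atTop (𝓝 1) := by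
      simpa using (hinv.const_mul t).const_sub 1
    set c : ℕ → ℝ := fun n => if 0 < 1 - t * (β n)⁻¹ then 1 - t * (β n)⁻¹ else 1 with hc
    have hcpos : ∀ n, 0 < c n := by
      intro n
      simp only [hc]
      split_ifs with h
      · exact h
      · exact one_pos
    have hceq : ∀ᶠ n in atTop, c n = 1 - t * (β n)⁻¹ := by
      filter_upwards [hd.eventually (lt_mem_nhds one_pos)] with n hn
      simp only [hc, if_pos hn]
    have hc1 : Tendsto c atTop (𝓝 1) := hd.congr' (hceq.mono fun n h => h.symm)
    have hci : Tendsto (fun n => (c n)⁻¹) atTop (𝓝 1) := by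
      simpa using hc1.inv₀ one_ne_zero
    refine ⟨fun n => ⟨aMat (c n)⁻¹ (inv_pos.mpr (hcpos n)).ne',
      ![α n * (1 - (c n)⁻¹), β n * (1 - (c n)⁻¹⁻¹)]⟩, ?_, ?_⟩
    · intro n
      rw [mem_conj_iff]
      exact ⟨(c n)⁻¹, inv_pos.mpr (hcpos n), rfl, rfl⟩
    · rw [gsl_tendsto_iff]
      refine ⟨?_, ?_⟩
      · intro i j
        fin_cases i <;> fin_cases j <;> simp [aMat, hci, hc1]
      · intro i
        fin_cases i
        · have h : Tendsto (fun n => -(t * (α n / β n) * (c n)⁻¹)) atTop (𝓝 0) := by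
            simpa using ((hr.const_mul t).mul hci).neg
          refine h.congr' ?_
          filter_upwards [hne, hceq] with n hn hcn
          have h0 := (hcpos n).ne'
          have : t * (β n)⁻¹ = 1 - c n := by linarith
          have e : t * (α n / β n) = α n * (1 - c n) := by rw [← this]; ring
          simp only [e]
          simp
          field_simp
          ring
        · refine tendsto_const_nhds.congr' ?_
          filter_upwards [hne, hceq] with n hn hcn
          simp [hcn]
          field_simp
  · intro k hk x hx l hl
    rw [gsl_tendsto_iff] at hl
    obtain ⟨hM, hV⟩ := hl
    simp only [mem_conj_iff] at hx
    choose a ha hg hv using hx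
    have hkt := hk.tendsto_atTop
    have h00 := hM 0 0
    have h01 := hM 0 1
    have h10 := hM 1 0
    have h11 := hM 1 1
    have hv0 := hV 0
    have hv1 := hV 1
    simp [hg] at h00 h01 h10 h11
    simp [hv] at hv0 hv1
    have hz : Tendsto (fun n => 1 - (a n)⁻¹) atTop (𝓝 0) := by
      have := (hinv.comp hkt).mul hv1
      rw [zero_mul] at this
      refine this.congr' ?_
      filter_upwards [hkt.eventually hne] with n hn
      simp only [Function.comp]
      field_simp
    have hai : Tendsto (fun n => (a n)⁻¹) atTop (𝓝 1) := by
      simpa using hz.const_sub 1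
    have ha1 : Tendsto a atTop (𝓝 1) := by
      simpa using hai.inv₀ one_ne_zero
    have hv0' : Tendsto (fun n => α (k n) * (1 - a n)) atTop (𝓝 0) := by
      have := ((hr.comp hkt).mul hv1).mul ha1.neg
      rw [zero_mul, zero_mul] at this
      refine this.congr' ?_
      filter_upwards [hkt.eventually hne] with n hn
      have h0 := (ha n).ne'
      simp only [Function.comp]
      field_simp
      ring
    have e00 := tendsto_nhds_unique h00 ha1
    have e11 := tendsto_nhds_unique h11 hai
    have e0 := tendsto_nhds_unique hv0 hv0'
    refine ⟨?_, l.v 1, ?_⟩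
    · ext i j
      fin_cases i <;> fin_cases j <;> simp [e00, e11, ← h01, ← h10]
    · ext i
      fin_cases i <;> simp [e0]
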